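/- Let E ⊂ ℝ be a Borel set, let μ ∈ R(E), and let θ ∈ L^∞(E) be an arbitrary bounded measurable function on E. Then the singular part μ_s of μ is supported by the set {x ∈ ℝ : (H̃_E θ)(x) exists}, where (H̃_E θ)(x) = lim_{y→0+} ∫_E ((t−x)/((t−x)²+y²) − t/(t²+1)) θ(t) dt (the set of x at which this limit exists and is finite). -/

import Mathlib

open MeasureTheory Filter Topology

/-- The Herglotz function associated with a positive Borel measure `μ` on `ℝ`
(satisfying `∫ dμ(t)/(t²+1) < ∞`) and constants `a ∈ ℝ`, `b ≥ 0`: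
`F(z) = a + b z + ∫ (1/(t - z) - t/(t² + 1)) dμ(t)`. -/
noncomputable def herglotzFn (μ : Measure ℝ) (a b : ℝ) (z : ℂ) : ℂ :=
  (a : ℂ) + (b : ℂ) * z +
    ∫ t : ℝ, (((t : ℂ) - z)⁻¹ - (t : ℂ) / ((t : ℂ) ^ 2 + 1)) ∂μ

/-- `μ ∈ R(E)`: the measure `μ` satisfies `∫ dμ(t)/(t²+1) < ∞` and for some choice of
`a ∈ ℝ`, `b ≥ 0` the associated Herglotz function `F_μ` is reflectionless on `E`, i.e.
its boundary value has vanishing real part at Lebesgue-a.e. point of `E`. -/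
def IsReflectionless (μ : Measure ℝ) (E : Set ℝ) : Prop :=
  Integrable (fun t : ℝ => (t ^ 2 + 1)⁻¹) μ ∧
  ∃ a b : ℝ, 0 ≤ b ∧
    ∀ᵐ t : ℝ ∂(volume.restrict E),
      Tendsto (fun y : ℝ => (herglotzFn μ a b ((t : ℂ) + y * Complex.I)).re)
        (𝓝[>] (0 : ℝ)) (𝓝 0)

/-- The (unnormalised) Poisson kernel of the upper half plane. -/
noncomputable def halfPlanePoisson (x y t : ℝ) : ℝ := y / ((t - x) ^ 2 + y ^ 2)

/-- The (unnormalised) Poisson integral of a measure on the line. -/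
noncomputable def poissonIntegral (μ : Measure ℝ) (x y : ℝ) : ℝ :=
  ∫ t, halfPlanePoisson x y t ∂μ

lemma halfPlanePoisson_pos {y : ℝ} (hy : 0 < y) (x t : ℝ) : 0 < halfPlanePoisson x y t := by
  unfold halfPlanePoisson; positivity

lemma continuous_halfPlanePoisson {y : ℝ} (hy : 0 < y) (x : ℝ) :
    Continuous (halfPlanePoisson x y) := by
  unfold halfPlanePoisson
  refine continuous_const.div (by fun_prop) fun t => by positivity

lemma inv_sq_add_sq_le {x y d t : ℝ} (hd : 0 < d) (h : d ^ 2 ≤ (t - x) ^ 2 + y ^ 2) :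
    ((t - x) ^ 2 + y ^ 2)⁻¹ ≤ (2 + (1 + 2 * x ^ 2) / d ^ 2) * (t ^ 2 + 1)⁻¹ := by
  have h0 : 0 < (t - x) ^ 2 + y ^ 2 := lt_of_lt_of_le (by positivity) h
  rw [← div_eq_mul_inv, inv_eq_one_div, div_le_div_iff₀ h0 (by positivity)]
  have h1 : 1 + 2 * x ^ 2 ≤ (1 + 2 * x ^ 2) / d ^ 2 * ((t - x) ^ 2 + y ^ 2) := by
    rw [div_mul_eq_mul_div, le_div_iff₀ (by positivity)]
    exact mul_le_mul_of_nonneg_left h (by positivity)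
  nlinarith [sq_nonneg (t - 2 * x), sq_nonneg y]

lemma halfPlanePoisson_le {y : ℝ} (hy : 0 < y) (x t : ℝ) :
    halfPlanePoisson x y t ≤ y * (2 + (1 + 2 * x ^ 2) / y ^ 2) * (t ^ 2 + 1)⁻¹ := by
  unfold halfPlanePoisson
  rw [div_eq_mul_inv, mul_assoc]
  exact mul_le_mul_of_nonneg_left (inv_sq_add_sq_le hy (by nlinarith [sq_nonneg (t - x)])) hy.le

section PoissonIntegral

variable {μ ρ : Measure ℝ}

lemma integrable_halfPlanePoisson (hμ : Integrable (fun t : ℝ => (t ^ 2 + 1)⁻¹) μ) {y : ℝ}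
    (hy : 0 < y) (x : ℝ) : Integrable (halfPlanePoisson x y) μ := by
  refine (hμ.const_mul (y * (2 + (1 + 2 * x ^ 2) / y ^ 2))).mono'
    (continuous_halfPlanePoisson hy x).aestronglyMeasurable (ae_of_all _ fun t => ?_)
  rw [Real.norm_of_nonneg (halfPlanePoisson_pos hy x t).le]
  exact halfPlanePoisson_le hy x t

lemma poissonIntegral_nonneg (μ : Measure ℝ) (x : ℝ) {y : ℝ} (hy : 0 < y) :
    0 ≤ poissonIntegral μ x y :=
  integral_nonneg fun t => (halfPlanePoisson_pos hy x t).le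

lemma poissonIntegral_pos (hμ : Integrable (fun t : ℝ => (t ^ 2 + 1)⁻¹) μ) (h0 : μ ≠ 0)
    (x : ℝ) {y : ℝ} (hy : 0 < y) : 0 < poissonIntegral μ x y := by
  rw [poissonIntegral, integral_pos_iff_support_of_nonneg
    (fun t => (halfPlanePoisson_pos hy x t).le) (integrable_halfPlanePoisson hμ hy x)]
  have : Function.support (halfPlanePoisson x y) = Set.univ :=
    Set.eq_univ_of_forall fun t => (halfPlanePoisson_pos hy x t).ne'
  rw [this]
  exact pos_iff_ne_zero.2 (by simpa using h0)

lemma poissonIntegral_volume (x : ℝ) {y : ℝ} (hy : 0 < y) :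
    poissonIntegral volume x y = Real.pi := by
  have h : ∀ t, halfPlanePoisson x y t = y⁻¹ * (1 + (y⁻¹ * (t - x)) ^ 2)⁻¹ := fun t => by
    have h1 : 0 < (t - x) ^ 2 + y ^ 2 := by positivity
    have h2 : 0 < 1 + (y⁻¹ * (t - x)) ^ 2 := by positivity
    unfold halfPlanePoisson
    field_simp
    ring
  unfold poissonIntegral
  simp_rw [h, integral_const_mul]
  rw [integral_sub_right_eq_self (μ := volume) (fun t => (1 + (y⁻¹ * t) ^ 2)⁻¹) x,
    Measure.integral_comp_mul_left (fun t : ℝ => (1 + t ^ 2)⁻¹) y⁻¹,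
    integral_univ_inv_one_add_sq]
  rw [inv_inv, abs_of_pos hy, smul_eq_mul, inv_mul_cancel_left₀ hy.ne']

lemma isLocallyFiniteMeasure_of_integrable_inv_sq
    (hμ : Integrable (fun t : ℝ => (t ^ 2 + 1)⁻¹) μ) : IsLocallyFiniteMeasure μ := by
  refine ⟨fun x => ⟨Metric.ball x 1, Metric.ball_mem_nhds x one_pos, ?_⟩⟩
  have h := hμ.measure_ge_lt_top (ε := ((|x| + 1) ^ 2 + 1)⁻¹) (by positivity)
  refine lt_of_le_of_lt (measure_mono fun t ht => ?_) h
  rw [Metric.mem_ball, Real.dist_eq] at ht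
  have h1 : |t| ≤ |x| + 1 := by
    have := abs_sub_abs_le_abs_sub t x
    linarith
  have h2 : t ^ 2 ≤ (|x| + 1) ^ 2 := by
    rw [← sq_abs t]; gcongr
  show _ ≤ (t ^ 2 + 1)⁻¹
  gcongr

lemma setOf_le_truncated_halfPlanePoisson {x y δ s : ℝ} (hy : 0 < y) (hδ : 0 < δ) (hs : 0 < s)
    (hne : s ≠ y⁻¹ - y / (δ ^ 2 + y ^ 2)) :
    {t | s ≤ max (halfPlanePoisson x y t - y / (δ ^ 2 + y ^ 2)) 0} = ∅ ∨
      ∃ r, 0 < r ∧ r ≤ δ ∧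
        {t | s ≤ max (halfPlanePoisson x y t - y / (δ ^ 2 + y ^ 2)) 0} = Metric.closedBall x r := by
  set κ := y / (δ ^ 2 + y ^ 2) with hκ
  have hκ0 : 0 < κ := by positivity
  have key : ∀ t, t ∈ {t | s ≤ max (halfPlanePoisson x y t - κ) 0} ↔
      (t - x) ^ 2 ≤ y / (κ + s) - y ^ 2 := fun t => by
    have h1 : 0 < (t - x) ^ 2 + y ^ 2 := by positivity
    simp only [Set.mem_ofPred_eq, le_max_iff, not_le.2 hs, or_false]
    rw [le_sub_iff_add_le, le_sub_iff_add_le, halfPlanePoisson, le_div_iff₀ h1,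
      le_div_iff₀ (by positivity), add_comm s κ, mul_comm]
  rcases lt_or_ge 0 (y / (κ + s) - y ^ 2) with h | h
  · right
    refine ⟨√(y / (κ + s) - y ^ 2), Real.sqrt_pos.2 h, ?_, ?_⟩
    · apply Real.sqrt_le_iff.2 ⟨hδ.le, ?_⟩
      have : y / (κ + s) ≤ y / κ := by gcongr; linarith
      have h2 : y / κ = δ ^ 2 + y ^ 2 := by rw [hκ]; field_simp
      linarith
    · ext t
      rw [key, Metric.mem_closedBall, Real.dist_eq, ← sq_abs]
      exact (Real.le_sqrt (abs_nonneg _) h.le).symm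
  · left
    ext t
    rw [key]
    simp only [Set.mem_empty_iff_false, iff_false, not_le]
    refine lt_of_lt_of_le (lt_of_le_of_ne h fun h0 => hne ?_) (sq_nonneg _)
    have h1 : y = y ^ 2 * (κ + s) := by
      have : y / (κ + s) = y ^ 2 := by linarith
      rwa [div_eq_iff (by positivity)] at this
    have h2 : κ + s = y⁻¹ := by
      field_simp
      have := mul_left_cancel₀ hy.ne' (show y * 1 = y * (y * (κ + s)) by nlinarith)
      linarith
    linarith

/-- Comparison of small balls centred at `x` gives comparison of Poisson integrals at `x`. -/
lemma poissonIntegral_le_of_closedBall_le (hρ : Integrable (fun t : ℝ => (t ^ 2 + 1)⁻¹) ρ)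
    (hμ : Integrable (fun t : ℝ => (t ^ 2 + 1)⁻¹) μ) {x δ : ℝ} (hδ : 0 < δ)
    (h : ∀ r, 0 < r → r ≤ δ → ρ (Metric.closedBall x r) ≤ μ (Metric.closedBall x r)) :
    ∃ K : ℝ, 0 ≤ K ∧ ∀ y, 0 < y → poissonIntegral ρ x y ≤ poissonIntegral μ x y + K * y := by
  refine ⟨(2 + (1 + 2 * x ^ 2) / δ ^ 2) * ∫ t : ℝ, (t ^ 2 + 1)⁻¹ ∂ρ,
    mul_nonneg (by positivity) (integral_nonneg fun t => by positivity), fun y hy => ?_⟩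
  set κ := y / (δ ^ 2 + y ^ 2) with hκ
  have hκ0 : 0 < κ := by positivity
  set f : ℝ → ℝ := fun t => max (halfPlanePoisson x y t - κ) 0 with hf
  have hf0 : ∀ t, 0 ≤ f t := fun t => le_max_right _ _
  have hfle : ∀ t, f t ≤ halfPlanePoisson x y t := fun t =>
    max_le (by linarith) (halfPlanePoisson_pos hy x t).le
  have hfc : Continuous f := by
    have := continuous_halfPlanePoisson hy x
    fun_prop
  have hfint : ∀ {ν : Measure ℝ}, Integrable (fun t : ℝ => (t ^ 2 + 1)⁻¹) ν → Integrable f ν :=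
    fun hν => (integrable_halfPlanePoisson hν hy x).mono' hfc.aestronglyMeasurable
      (ae_of_all _ fun t => by rw [Real.norm_of_nonneg (hf0 t)]; exact hfle t)
  have hlin : ∫⁻ t, ENNReal.ofReal (f t) ∂ρ ≤ ∫⁻ t, ENNReal.ofReal (f t) ∂μ := by
    rw [lintegral_eq_lintegral_meas_le ρ (ae_of_all _ hf0) hfc.aemeasurable,
      lintegral_eq_lintegral_meas_le μ (ae_of_all _ hf0) hfc.aemeasurable]
    refine lintegral_mono_ae ?_
    have hne : ∀ᵐ s : ℝ ∂(volume.restrict (Set.Ioi 0)), s ≠ y⁻¹ - κ :=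
      ae_restrict_of_ae (Measure.ae_ne volume _)
    filter_upwards [hne, ae_restrict_mem measurableSet_Ioi] with s hs hs0
    rcases setOf_le_truncated_halfPlanePoisson (x := x) hy hδ hs0 hs with he | ⟨r, hr, hrδ, he⟩
    · simp only [hf, hκ, he, measure_empty, le_refl]
    · simp only [hf, hκ, he, h r hr hrδ]
  have h1 : ∫ t, f t ∂ρ ≤ ∫ t, f t ∂μ := by
    rw [integral_eq_lintegral_of_nonneg_ae (ae_of_all _ hf0) hfc.aestronglyMeasurable,
      integral_eq_lintegral_of_nonneg_ae (ae_of_all _ hf0) hfc.aestronglyMeasurable]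
    refine ENNReal.toReal_mono ?_ hlin
    exact (hfint hμ).lintegral_lt_top.ne
  have h2 : ∫ t, f t ∂μ ≤ poissonIntegral μ x y :=
    integral_mono (hfint hμ) (integrable_halfPlanePoisson hμ hy x) hfle
  have h3 : poissonIntegral ρ x y ≤
      ∫ t, (f t + y * (2 + (1 + 2 * x ^ 2) / δ ^ 2) * (t ^ 2 + 1)⁻¹) ∂ρ := by
    refine integral_mono (integrable_halfPlanePoisson hρ hy x)
      ((hfint hρ).add (hρ.const_mul _)) fun t => ?_
    show halfPlanePoisson x y t ≤ f t + _
    rcases le_or_gt (halfPlanePoisson x y t) κ with hk | hk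
    · refine le_add_of_nonneg_of_le (hf0 t) ?_
      have hd : δ ^ 2 ≤ (t - x) ^ 2 := by
        rw [hκ, halfPlanePoisson, div_le_div_iff_of_pos_left hy (by positivity) (by positivity)]
          at hk
        linarith
      rw [halfPlanePoisson, div_eq_mul_inv, mul_assoc]
      exact mul_le_mul_of_nonneg_left (inv_sq_add_sq_le hδ (by nlinarith [sq_nonneg y])) hy.le
    · have hκle : κ ≤ y * ((2 + (1 + 2 * x ^ 2) / δ ^ 2) * (t ^ 2 + 1)⁻¹) := by
        have hlt : (t - x) ^ 2 ≤ δ ^ 2 := by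
          rw [hκ, halfPlanePoisson,
            div_lt_div_iff_of_pos_left hy (by positivity) (by positivity)] at hk
          linarith
        have : (t - x) ^ 2 + √(δ ^ 2 + y ^ 2 - (t - x) ^ 2) ^ 2 = δ ^ 2 + y ^ 2 := by
          rw [Real.sq_sqrt (by nlinarith [sq_nonneg y])]; ring
        have h5 := inv_sq_add_sq_le (x := x) (t := t) (y := √(δ ^ 2 + y ^ 2 - (t - x) ^ 2)) hδ
          (by rw [this]; nlinarith [sq_nonneg y])
        rw [this] at h5
        rw [hκ, div_eq_mul_inv]
        exact mul_le_mul_of_nonneg_left h5 hy.le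
      have : f t = halfPlanePoisson x y t - κ := max_eq_left (by linarith)
      rw [this, mul_assoc]
      linarith
  rw [integral_add (hfint hρ) (hρ.const_mul _), integral_const_mul] at h3
  nlinarith

lemma poissonIntegral_nnreal_smul (c : NNReal) (μ : Measure ℝ) (x y : ℝ) :
    poissonIntegral (c • μ) x y = c * poissonIntegral μ x y := by
  rw [poissonIntegral, integral_smul_nnreal_measure]; rfl

/-- A strict comparison of the measures of small balls, in terms of an ENNReal ratio. -/
lemma exists_closedBall_le_of_tendsto_div {ρ μ : Measure ℝ} {x : ℝ} {D : ENNReal} {D' : NNReal}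
    [IsLocallyFiniteMeasure μ] (hD : D < D')
    (h : Tendsto (fun r => ρ (Metric.closedBall x r) / μ (Metric.closedBall x r)) (𝓝[>] 0) (𝓝 D)) :
    ∃ δ > 0, ∀ r, 0 < r → r ≤ δ →
      ρ (Metric.closedBall x r) ≤ (D' • μ) (Metric.closedBall x r) := by
  obtain ⟨δ, hδ, hs⟩ := mem_nhdsGT_iff_exists_Ioc_subset.1 (h.eventually (gt_mem_nhds hD))
  refine ⟨δ, hδ, fun r hr hrδ => ?_⟩
  have h1 : ρ (Metric.closedBall x r) / μ (Metric.closedBall x r) < D' := hs ⟨hr, hrδ⟩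
  have h2 : μ (Metric.closedBall x r) ≠ ⊤ := (isCompact_closedBall x r).measure_ne_top
  rw [Measure.smul_apply, ENNReal.smul_def, smul_eq_mul]
  exact (ENNReal.div_le_iff_le_mul (Or.inr ENNReal.coe_ne_top) (Or.inl h2)).1 h1.le

lemma exists_closedBall_ge_of_tendsto_div {ρ μ : Measure ℝ} {x : ℝ} {D : ENNReal} {D' : NNReal}
    (hD : D' < D)
    (h : Tendsto (fun r => ρ (Metric.closedBall x r) / μ (Metric.closedBall x r)) (𝓝[>] 0) (𝓝 D)) :
    ∃ δ > 0, ∀ r, 0 < r → r ≤ δ →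
      (D' • μ) (Metric.closedBall x r) ≤ ρ (Metric.closedBall x r) := by
  obtain ⟨δ, hδ, hs⟩ := mem_nhdsGT_iff_exists_Ioc_subset.1 (h.eventually (lt_mem_nhds hD))
  refine ⟨δ, hδ, fun r hr hrδ => ?_⟩
  have h1 : (D' : ENNReal) < ρ (Metric.closedBall x r) / μ (Metric.closedBall x r) := hs ⟨hr, hrδ⟩
  rw [Measure.smul_apply, ENNReal.smul_def, smul_eq_mul]
  exact ENNReal.mul_le_of_le_div h1.le

lemma integrable_inv_sq_volume : Integrable (fun t : ℝ => (t ^ 2 + 1)⁻¹) volume := by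
  simpa [add_comm] using integrable_inv_one_add_sq

/-- Ratios of Poisson integrals converge to the Radon-Nikodym derivative. -/
theorem ae_tendsto_poissonIntegral_div (hρ : Integrable (fun t : ℝ => (t ^ 2 + 1)⁻¹) ρ)
    (hμ : Integrable (fun t : ℝ => (t ^ 2 + 1)⁻¹) μ) :
    ∀ᵐ x ∂μ, (∃ c > 0, ∀ᶠ y in 𝓝[>] (0 : ℝ), c ≤ poissonIntegral μ x y) ∧
      Tendsto (fun y => poissonIntegral ρ x y / poissonIntegral μ x y) (𝓝[>] 0)
        (𝓝 (ρ.rnDeriv μ x).toReal) := by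
  have := isLocallyFiniteMeasure_of_integrable_inv_sq hρ
  have := isLocallyFiniteMeasure_of_integrable_inv_sq hμ
  filter_upwards [Besicovitch.ae_tendsto_rnDeriv ρ μ, Besicovitch.ae_tendsto_rnDeriv volume μ,
    ρ.rnDeriv_lt_top μ, (volume : Measure ℝ).rnDeriv_lt_top μ] with x h1 h2 h3 h4
  have hlin : ∀ K a : ℝ, 0 < a → ∀ᶠ y in 𝓝[>] (0 : ℝ), K * y < a := fun K a ha => by
    have : Tendsto (fun y : ℝ => K * y) (𝓝[>] 0) (𝓝 (K * 0)) :=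
      ((continuous_const.mul continuous_id).tendsto 0).mono_left nhdsWithin_le_nhds
    rw [mul_zero] at this
    exact this.eventually (gt_mem_nhds ha)
  have hlow : ∃ c > 0, ∀ᶠ y in 𝓝[>] (0 : ℝ), c ≤ poissonIntegral μ x y := by
    obtain ⟨D, hD⟩ := ENNReal.lt_iff_exists_nnreal_btwn.1 h4
    obtain ⟨δ, hδ, hb⟩ := exists_closedBall_le_of_tendsto_div hD.1 h2
    obtain ⟨K, -, hK⟩ := poissonIntegral_le_of_closedBall_le integrable_inv_sq_volume
      (hμ.smul_measure_nnreal (c := D)) hδ hb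
    refine ⟨1 / (D + 1), by positivity, ?_⟩
    filter_upwards [hlin K 1 one_pos, self_mem_nhdsWithin] with y hy hy0
    have h5 := hK y hy0
    rw [poissonIntegral_volume x hy0, poissonIntegral_nnreal_smul] at h5
    rw [div_le_iff₀ (by positivity)]
    nlinarith [Real.pi_gt_three, poissonIntegral_nonneg μ x hy0]
  refine ⟨hlow, ?_⟩
  obtain ⟨c, hc, hcy⟩ := hlow
  refine tendsto_order.2 ⟨fun a ha => ?_, fun a ha => ?_⟩
  · rcases lt_or_ge a 0 with ha0 | ha0
    · filter_upwards [self_mem_nhdsWithin] with y hy0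
      exact lt_of_lt_of_le ha0
        (div_nonneg (poissonIntegral_nonneg ρ x hy0) (poissonIntegral_nonneg μ x hy0))
    obtain ⟨b, hab, hb⟩ := exists_between ha
    lift b to NNReal using ha0.trans hab.le
    have hbD : (b : ENNReal) < ρ.rnDeriv μ x := by
      rw [← ENNReal.ofReal_coe_nnreal]
      exact (ENNReal.ofReal_lt_iff_lt_toReal b.2 h3.ne).2 hb
    obtain ⟨δ, hδ, hball⟩ := exists_closedBall_ge_of_tendsto_div hbD h1
    obtain ⟨K, -, hK⟩ := poissonIntegral_le_of_closedBall_le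
      (hμ.smul_measure_nnreal (c := b)) hρ hδ hball
    filter_upwards [hcy, hlin K ((b - a) * c) (mul_pos (by linarith) hc), self_mem_nhdsWithin]
      with y hy1 hy2 hy0
    have h5 := hK y hy0
    rw [poissonIntegral_nnreal_smul] at h5
    rw [lt_div_iff₀ (hc.trans_le hy1)]
    nlinarith
  · obtain ⟨b, hb, hab⟩ := exists_between ha
    lift b to NNReal using ENNReal.toReal_nonneg.trans hb.le
    have hbD : ρ.rnDeriv μ x < b := by
      rw [← ENNReal.ofReal_coe_nnreal]
      exact (ENNReal.lt_ofReal_iff_toReal_lt h3.ne).2 hb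
    obtain ⟨δ, hδ, hball⟩ := exists_closedBall_le_of_tendsto_div hbD h1
    obtain ⟨K, -, hK⟩ := poissonIntegral_le_of_closedBall_le hρ
      (hμ.smul_measure_nnreal (c := b)) hδ hball
    filter_upwards [hcy, hlin K ((a - b) * c) (mul_pos (by linarith) hc), self_mem_nhdsWithin]
      with y hy1 hy2 hy0
    have h5 := hK y hy0
    rw [poissonIntegral_nnreal_smul] at h5
    rw [div_lt_iff₀ (hc.trans_le hy1)]
    nlinarith

end PoissonIntegral

/-- The Cayley transform of the unit disc onto the upper half plane. -/
noncomputable def discToHalfPlane (w : ℂ) : ℂ := Complex.I * (1 + w) / (1 - w)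

lemma one_sub_ne_zero_of_norm_lt_one {w : ℂ} (hw : ‖w‖ < 1) : 1 - w ≠ 0 := by
  intro h
  rw [← sub_eq_zero.1 h, norm_one] at hw
  exact lt_irrefl _ hw

lemma discToHalfPlane_im_pos {w : ℂ} (hw : ‖w‖ < 1) : 0 < (discToHalfPlane w).im := by
  have h0 : 0 < Complex.normSq (1 - w) := Complex.normSq_pos.2 (one_sub_ne_zero_of_norm_lt_one hw)
  have h1 : Complex.normSq w < 1 := by
    rw [Complex.normSq_eq_norm_sq]; nlinarith [norm_nonneg w]
  rw [Complex.normSq_apply] at h1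
  have : (discToHalfPlane w).im = (1 - Complex.normSq w) / Complex.normSq (1 - w) := by
    rw [discToHalfPlane, Complex.div_im]
    simp [Complex.normSq_apply]
    ring
  rw [this, Complex.normSq_apply w]
  exact div_pos (by linarith) h0

lemma differentiableAt_discToHalfPlane {w : ℂ} (hw : ‖w‖ < 1) :
    DifferentiableAt ℂ discToHalfPlane w := by
  unfold discToHalfPlane
  exact ((differentiableAt_const _).mul ((differentiableAt_const _).add differentiableAt_id)).div
    ((differentiableAt_const _).sub differentiableAt_id) (one_sub_ne_zero_of_norm_lt_one hw)

/-- The Poisson kernel of the disc, with the boundary parametrised by the angle. -/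
noncomputable def discPoisson (w : ℂ) (θ : ℝ) : ℝ := poissonKernel 0 w (circleMap 0 1 θ)

lemma circleMap_sub_ne_zero {w : ℂ} (hw : ‖w‖ < 1) (θ : ℝ) : circleMap 0 1 θ - w ≠ 0 := by
  intro h
  rw [← sub_eq_zero.1 h] at hw
  simp at hw

lemma discPoisson_eq (w : ℂ) (θ : ℝ) :
    discPoisson w θ = (1 - ‖w‖ ^ 2) / ‖circleMap 0 1 θ - w‖ ^ 2 := by
  simp [discPoisson, poissonKernel_def]

lemma continuous_discPoisson {w : ℂ} (hw : ‖w‖ < 1) : Continuous (discPoisson w) := by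
  simp_rw [funext (discPoisson_eq w)]
  refine continuous_const.div (by fun_prop) fun θ => ?_
  exact pow_ne_zero 2 (norm_ne_zero_iff.2 (circleMap_sub_ne_zero hw θ))

lemma norm_discPoisson_le {w : ℂ} (hw : ‖w‖ < 1) (θ : ℝ) :
    ‖discPoisson w θ‖ ≤ (1 - ‖w‖ ^ 2) / (1 - ‖w‖) ^ 2 := by
  have h1 : 1 - ‖w‖ ≤ ‖circleMap 0 1 θ - w‖ := by
    simpa using norm_sub_norm_le (circleMap 0 1 θ) w
  have h2 : 0 < 1 - ‖w‖ := by linarith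
  have h3 : 0 ≤ 1 - ‖w‖ ^ 2 := by nlinarith [norm_nonneg w]
  rw [discPoisson_eq, Real.norm_of_nonneg (by positivity)]
  gcongr

/-- `discPoisson` as a bounded continuous function. -/
noncomputable def discPoissonBCF {w : ℂ} (hw : ‖w‖ < 1) : BoundedContinuousFunction ℝ ℝ :=
  BoundedContinuousFunction.ofNormedAddCommGroup (discPoisson w) (continuous_discPoisson hw) _
    (norm_discPoisson_le hw)

/-- Poisson formula for a dilated function on the disc, written with a density on `[0, 2π]`. -/
lemma integral_discPoisson_dilated {f : ℂ → ℂ} (hf : DifferentiableOn ℂ f (Metric.ball 0 1))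
    {r : ℝ} (hr0 : 0 ≤ r) (hr : r < 1) {w : ℂ} (hw : ‖w‖ < 1) :
    ∫ θ in Set.Ioc 0 (2 * Real.pi), (f (r * circleMap 0 1 θ)).im / (2 * Real.pi) * discPoisson w θ
      = (f (r * w)).im := by
  have hmaps : ∀ v : ℂ, ‖v‖ ≤ 1 → (r : ℂ) * v ∈ Metric.ball (0 : ℂ) 1 := fun v hv => by
    rw [mem_ball_zero_iff, norm_mul, Complex.norm_real, Real.norm_of_nonneg hr0]
    nlinarith [norm_nonneg v]
  have hg : DiffContOnCl ℂ (fun v => f (r * v)) (Metric.ball 0 1) := by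
    refine DifferentiableOn.diffContOnCl fun v hv => ?_
    rw [closure_ball _ one_ne_zero, mem_closedBall_zero_iff] at hv
    refine DifferentiableAt.differentiableWithinAt ?_
    exact ((hf _ (hmaps v hv)).differentiableAt (Metric.isOpen_ball.mem_nhds (hmaps v hv))).comp v
      (by fun_prop)
  have h := hg.circleAverage_poissonKernel_smul (w := w) (by simpa using hw)
  rw [Real.circleAverage_def, intervalIntegral.integral_of_le (by positivity)] at h
  have hcont : Continuous fun θ : ℝ => (poissonKernel 0 w (circleMap 0 1 θ)) •
      f (r * circleMap 0 1 θ) := by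
    refine (continuous_discPoisson hw).smul ?_
    refine hf.continuousOn.comp_continuous (by fun_prop) fun θ => hmaps _ (by simp)
  have hint : IntegrableOn (fun θ : ℝ => (poissonKernel 0 w (circleMap 0 1 θ)) •
      f (r * circleMap 0 1 θ)) (Set.Ioc 0 (2 * Real.pi)) :=
    (hcont.integrableOn_Icc).mono_set Set.Ioc_subset_Icc_self
  have h2 := congrArg Complex.im h
  simp only [Complex.smul_im, Pi.smul_apply', smul_eq_mul] at h2
  rw [← h2]
  have h3 := integral_im hint
  simp only [RCLike.im_eq_complex_im] at h3
  rw [← h3, ← integral_const_mul]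
  refine integral_congr_ae (ae_of_all _ fun θ => ?_)
  simp only [discPoisson, Complex.smul_im, smul_eq_mul]
  ring

/-- Herglotz representation in the disc. -/
theorem exists_measure_disc {f : ℂ → ℂ} (hf : DifferentiableOn ℂ f (Metric.ball 0 1))
    (hpos : ∀ w, ‖w‖ < 1 → 0 ≤ (f w).im) :
    ∃ ν : Measure ℝ, IsFiniteMeasure ν ∧
      ∀ w, ‖w‖ < 1 → (f w).im = ∫ θ, discPoisson w θ ∂ν := by
  set r : ℕ → ℝ := fun n => 1 - 1 / ((n : ℝ) + 1) with hr
  have hr0 : ∀ n, 0 ≤ r n := fun n => by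
    have : (1 : ℝ) / ((n : ℝ) + 1) ≤ 1 := by
      rw [div_le_one (by positivity)]; linarith [Nat.cast_nonneg (α := ℝ) n]
    simp only [hr]; linarith
  have hr1 : ∀ n, r n < 1 := fun n => by
    have : (0 : ℝ) < 1 / ((n : ℝ) + 1) := by positivity
    simp only [hr]; linarith
  have hrt : Tendsto r atTop (𝓝 1) := by
    simpa [hr] using (tendsto_const_nhds (x := (1 : ℝ))).sub tendsto_one_div_add_atTop_nhds_zero_nat
  set d : ℕ → ℝ → ℝ := fun n θ => (f (r n * circleMap 0 1 θ)).im / (2 * Real.pi) with hd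
  have hball : ∀ n θ, (r n : ℂ) * circleMap 0 1 θ ∈ Metric.ball (0 : ℂ) 1 := fun n θ => by
    rw [mem_ball_zero_iff, norm_mul, Complex.norm_real, Real.norm_of_nonneg (hr0 n)]
    simpa using hr1 n
  have hd0 : ∀ n θ, 0 ≤ d n θ := fun n θ =>
    div_nonneg (hpos _ (mem_ball_zero_iff.1 (hball n θ))) (by positivity)
  have hdc : ∀ n, Continuous (d n) := fun n => by
    have : Continuous fun θ : ℝ => f (r n * circleMap 0 1 θ) :=
      hf.continuousOn.comp_continuous (by fun_prop) (hball n)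
    exact (Complex.continuous_im.comp this).div_const _
  set m : ℕ → Measure ℝ := fun n =>
    (volume.restrict (Set.Ioc 0 (2 * Real.pi))).withDensity fun θ => ENNReal.ofReal (d n θ) with hm
  have hint : ∀ n (g : ℝ → ℝ), ∫ θ, g θ ∂(m n) =
      ∫ θ in Set.Ioc 0 (2 * Real.pi), d n θ * g θ := fun n g => by
    simp only [hm]
    rw [integral_withDensity_eq_integral_toReal_smul
      (hdc n).measurable.ennreal_ofReal (ae_of_all _ fun θ => ENNReal.ofReal_lt_top)]
    refine integral_congr_ae (ae_of_all _ fun θ => ?_)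
    simp [ENNReal.toReal_ofReal (hd0 n θ)]
  have hdi : ∀ n, Integrable (d n) (volume.restrict (Set.Ioc 0 (2 * Real.pi))) := fun n =>
    ((hdc n).integrableOn_Icc).mono_set Set.Ioc_subset_Icc_self
  have hfin : ∀ n, IsFiniteMeasure (m n) := fun n =>
    isFiniteMeasure_withDensity_ofReal (hdi n).2
  have hP : ∀ n w, ‖w‖ < 1 → ∫ θ, discPoisson w θ ∂(m n) = (f (r n * w)).im := fun n w hw => by
    rw [hint]; exact integral_discPoisson_dilated hf (hr0 n) (hr1 n) hw
  set M : ℕ → FiniteMeasure ℝ := fun n => ⟨m n, hfin n⟩ with hM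
  have hK := isCompact_setOfPred_finiteMeasure_le_of_isCompact (E := ℝ) (f 0).im.toNNReal
    (isCompact_Icc (a := (0 : ℝ)) (b := 2 * Real.pi))
  have hmem : ∀ n, M n ∈ {μ : FiniteMeasure ℝ | μ.mass ≤ (f 0).im.toNNReal ∧
      μ (Set.Icc (0 : ℝ) (2 * Real.pi))ᶜ = 0} := fun n => by
    constructor
    · have h := hP n 0 (by simp)
      have h1 : ∀ θ, discPoisson 0 θ = 1 := fun θ => by simp [discPoisson_eq]
      simp only [h1, integral_const, smul_eq_mul, mul_one, mul_zero] at h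
      rw [← h]
      refine NNReal.coe_le_coe.1 ?_
      rw [Real.coe_toNNReal _ measureReal_nonneg]
      exact le_of_eq rfl
    · have : m n (Set.Icc (0 : ℝ) (2 * Real.pi))ᶜ = 0 := by
        refine withDensity_absolutelyContinuous _ _ ?_
        rw [Measure.restrict_apply measurableSet_Icc.compl]
        refine measure_mono_null (t := ∅) (fun t ht => ht.1 ⟨ht.2.1.le, ht.2.2⟩) measure_empty
      rw [FiniteMeasure.null_iff_toMeasure_null]
      exact this
  obtain ⟨ν, -, hν⟩ := hK.ultrafilter_le_nhds' ((hyperfilter ℕ).map M)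
    (Filter.Eventually.of_forall (f := (hyperfilter ℕ : Filter ℕ)) hmem)
  have hν' : Tendsto M (hyperfilter ℕ) (𝓝 ν) := hν
  refine ⟨ν, inferInstance, fun w hw => ?_⟩
  have h1 := FiniteMeasure.tendsto_iff_forall_integral_tendsto.1 hν' (discPoissonBCF hw)
  have h2 : Tendsto (fun n => (f (r n * w)).im) (hyperfilter ℕ) (𝓝 (f w).im) := by
    refine Tendsto.mono_left ?_ Nat.hyperfilter_le_atTop
    have hc : ContinuousAt (fun v => (f v).im) w :=
      Complex.continuous_im.continuousAt.comp
        (hf.continuousOn.continuousAt (Metric.isOpen_ball.mem_nhds (by simpa using hw)))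
    have h3 : Tendsto (fun n => (r n : ℂ) * w) atTop (𝓝 w) := by
      have := ((Complex.continuous_ofReal.tendsto 1).comp hrt).mul_const w
      simpa using this
    exact hc.tendsto.comp h3
  refine tendsto_nhds_unique h2 (h1.congr fun n => ?_)
  exact hP n w hw

/-- The inverse Cayley transform of the upper half plane onto the unit disc. -/
noncomputable def halfPlaneToDisc (z : ℂ) : ℂ := (z - Complex.I) / (z + Complex.I)

lemma add_I_ne_zero_of_im_pos {z : ℂ} (hz : 0 < z.im) : z + Complex.I ≠ 0 := by
  intro h
  have := congrArg Complex.im h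
  simp at this
  linarith

lemma norm_halfPlaneToDisc_lt_one {z : ℂ} (hz : 0 < z.im) : ‖halfPlaneToDisc z‖ < 1 := by
  rw [halfPlaneToDisc, norm_div, div_lt_one (norm_pos_iff.2 (add_I_ne_zero_of_im_pos hz))]
  refine lt_of_pow_lt_pow_left₀ 2 (norm_nonneg _) ?_
  rw [← Complex.normSq_eq_norm_sq, ← Complex.normSq_eq_norm_sq, Complex.normSq_apply,
    Complex.normSq_apply]
  simp
  nlinarith

lemma discToHalfPlane_halfPlaneToDisc {z : ℂ} (hz : 0 < z.im) :
    discToHalfPlane (halfPlaneToDisc z) = z := by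
  have h1 := add_I_ne_zero_of_im_pos hz
  have h2 := one_sub_ne_zero_of_norm_lt_one (norm_halfPlaneToDisc_lt_one hz)
  rw [discToHalfPlane, div_eq_iff h2]
  unfold halfPlaneToDisc
  field_simp
  ring

lemma discPoisson_halfPlaneToDisc (x : ℝ) {y : ℝ} (hy : 0 < y) (θ : ℝ) :
    discPoisson (halfPlaneToDisc (x + y * Complex.I)) θ =
      y / ((Real.sin (θ / 2) * x + Real.cos (θ / 2)) ^ 2 + (Real.sin (θ / 2) * y) ^ 2) := by
  set z : ℂ := x + y * Complex.I with hz
  have hzi : 0 < z.im := by simp [hz, hy]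
  have h1 := add_I_ne_zero_of_im_pos hzi
  set s := Real.sin (θ / 2)
  set c := Real.cos (θ / 2)
  have hcs : s ^ 2 + c ^ 2 = 1 := Real.sin_sq_add_cos_sq _
  have hcirc : circleMap 0 1 θ = ⟨2 * c ^ 2 - 1, 2 * s * c⟩ := by
    have h2 : θ = 2 * (θ / 2) := by ring
    have h3 : Real.cos θ = 2 * c ^ 2 - 1 := by
      rw [h2, Real.cos_two_mul]
    have h4 : Real.sin θ = 2 * s * c := by
      rw [h2, Real.sin_two_mul]
    rw [circleMap_zero, Complex.exp_mul_I]
    apply Complex.ext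
    · simp [Complex.cos_ofReal_re, h3, Complex.sin_ofReal_im]
    · simp [Complex.sin_ofReal_re, h4, Complex.cos_ofReal_im]
  have hN : 0 < Complex.normSq (z + Complex.I) := Complex.normSq_pos.2 h1
  rw [discPoisson_eq]
  have e1 : 1 - ‖halfPlaneToDisc z‖ ^ 2 = 4 * y / Complex.normSq (z + Complex.I) := by
    rw [halfPlaneToDisc, norm_div, div_pow, ← Complex.normSq_eq_norm_sq,
      ← Complex.normSq_eq_norm_sq, eq_div_iff hN.ne', sub_mul, div_mul_cancel₀ _ hN.ne']
    simp [Complex.normSq_apply, hz]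
    ring
  have e2 : ‖circleMap 0 1 θ - halfPlaneToDisc z‖ ^ 2 =
      4 * ((s * x + c) ^ 2 + (s * y) ^ 2) / Complex.normSq (z + Complex.I) := by
    have : circleMap 0 1 θ - halfPlaneToDisc z =
        (circleMap 0 1 θ * (z + Complex.I) - (z - Complex.I)) / (z + Complex.I) := by
      rw [halfPlaneToDisc]; field_simp
    rw [this, norm_div, div_pow, ← Complex.normSq_eq_norm_sq, ← Complex.normSq_eq_norm_sq, hcirc]
    congr 1
    simp [Complex.normSq_apply, hz]
    have hs2 : s ^ 2 = 1 - c ^ 2 := by linarith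
    ring_nf
    simp only [hs2]
    ring
  rw [e1, e2, div_div_div_cancel_right₀ hN.ne', mul_div_mul_left _ _ (by norm_num)]

lemma discPoisson_of_sin_eq_zero (x : ℝ) {y : ℝ} (hy : 0 < y) {θ : ℝ}
    (h : Real.sin (θ / 2) = 0) : discPoisson (halfPlaneToDisc (x + y * Complex.I)) θ = y := by
  rw [discPoisson_halfPlaneToDisc x hy, h]
  have := Real.sin_sq_add_cos_sq (θ / 2)
  rw [h] at this
  have h2 : Real.cos (θ / 2) ^ 2 = 1 := by linarith
  simp [h2]

lemma discPoisson_of_sin_ne_zero (x : ℝ) {y : ℝ} (hy : 0 < y) {θ : ℝ}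
    (h : Real.sin (θ / 2) ≠ 0) : discPoisson (halfPlaneToDisc (x + y * Complex.I)) θ =
      (1 + (-Real.cos (θ / 2) / Real.sin (θ / 2)) ^ 2) *
        halfPlanePoisson x y (-Real.cos (θ / 2) / Real.sin (θ / 2)) := by
  rw [discPoisson_halfPlaneToDisc x hy, halfPlanePoisson]
  set s := Real.sin (θ / 2)
  set c := Real.cos (θ / 2)
  have hcs : s ^ 2 + c ^ 2 = 1 := Real.sin_sq_add_cos_sq _
  have e1 : 1 + (-c / s) ^ 2 = 1 / s ^ 2 := by
    have : 1 + (-c / s) ^ 2 = (s ^ 2 + c ^ 2) / s ^ 2 := by field_simp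
    rw [this, hcs]
  have e2 : (s * x + c) ^ 2 + (s * y) ^ 2 = s ^ 2 * ((-c / s - x) ^ 2 + y ^ 2) := by
    field_simp
    ring
  rw [e1, e2, div_mul_div_comm, one_mul]

/-- Herglotz representation in the upper half plane. -/
theorem exists_poissonIntegral_repr {H : ℂ → ℂ} (hH : DifferentiableOn ℂ H {z | 0 < z.im})
    (hpos : ∀ z : ℂ, 0 < z.im → 0 ≤ (H z).im) :
    ∃ (β : ℝ) (ρ : Measure ℝ), 0 ≤ β ∧ Integrable (fun t : ℝ => (t ^ 2 + 1)⁻¹) ρ ∧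
      ∀ x y : ℝ, 0 < y → (H (x + y * Complex.I)).im = β * y + poissonIntegral ρ x y := by
  have hopen : IsOpen {z : ℂ | 0 < z.im} := isOpen_lt continuous_const Complex.continuous_im
  obtain ⟨ν, hν, hrep⟩ := exists_measure_disc (f := fun w => H (discToHalfPlane w))
    (fun w hw => by
      rw [mem_ball_zero_iff] at hw
      have h1 : discToHalfPlane w ∈ {z : ℂ | 0 < z.im} := discToHalfPlane_im_pos hw
      exact (((hH _ h1).differentiableAt (hopen.mem_nhds h1)).comp w
        (differentiableAt_discToHalfPlane hw)).differentiableWithinAt)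
    (fun w hw => hpos _ (discToHalfPlane_im_pos hw))
  set N : Set ℝ := {θ | Real.sin (θ / 2) = 0} with hN
  have hNm : MeasurableSet N := by
    apply measurableSet_eq_fun <;> fun_prop
  set T : ℝ → ℝ := fun θ => -Real.cos (θ / 2) / Real.sin (θ / 2) with hT
  have hTm : Measurable T := by fun_prop
  set σ : Measure ℝ := (ν.restrict Nᶜ).map T with hσ
  set ρ : Measure ℝ := σ.withDensity fun t => ENNReal.ofReal (1 + t ^ 2) with hρ
  have hdm : Measurable fun t : ℝ => ENNReal.ofReal (1 + t ^ 2) := by fun_prop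
  have hσf : IsFiniteMeasure σ := by rw [hσ]; infer_instance
  have hint : ∀ g : ℝ → ℝ, ∫ t, g t ∂ρ = ∫ t, (1 + t ^ 2) * g t ∂σ := fun g => by
    rw [hρ, integral_withDensity_eq_integral_toReal_smul hdm
      (ae_of_all _ fun t => ENNReal.ofReal_lt_top)]
    refine integral_congr_ae (ae_of_all _ fun t => ?_)
    simp [ENNReal.toReal_ofReal (show (0 : ℝ) ≤ 1 + t ^ 2 by positivity)]
  refine ⟨ν.real N, ρ, measureReal_nonneg, ?_, fun x y hy => ?_⟩
  · rw [hρ, integrable_withDensity_iff_integrable_smul' hdm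
      (ae_of_all _ fun t => ENNReal.ofReal_lt_top)]
    refine (integrable_const (1 : ℝ)).congr (ae_of_all _ fun t => ?_)
    have h0 : (0 : ℝ) < 1 + t ^ 2 := by positivity
    simp only [ENNReal.toReal_ofReal h0.le, smul_eq_mul]
    rw [add_comm (t ^ 2) 1, mul_inv_cancel₀ h0.ne']
  · have hz : 0 < ((x : ℂ) + y * Complex.I).im := by simpa using hy
    have h1 := hrep _ (norm_halfPlaneToDisc_lt_one hz)
    simp only [discToHalfPlane_halfPlaneToDisc hz] at h1
    have hi : Integrable (discPoisson (halfPlaneToDisc (x + y * Complex.I))) ν :=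
      (discPoissonBCF (norm_halfPlaneToDisc_lt_one hz)).integrable ν
    rw [h1, ← integral_add_compl hNm hi]
    congr 1
    · rw [setIntegral_congr_fun hNm (g := fun _ => y)
        fun θ hθ => discPoisson_of_sin_eq_zero x hy hθ]
      simp
    · rw [poissonIntegral, hint, hσ, integral_map hTm.aemeasurable]
      · exact setIntegral_congr_fun hNm.compl fun θ hθ => discPoisson_of_sin_ne_zero x hy hθ
      · refine Continuous.aestronglyMeasurable ?_
        have := continuous_halfPlanePoisson hy x
        fun_prop

lemma norm_ofReal_sub_pos {z : ℂ} (hz : 0 < z.im) (t : ℝ) : 0 < ‖(t : ℂ) - z‖ := by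
  refine norm_pos_iff.2 fun h => ?_
  have := congrArg Complex.im h
  simp at this
  linarith

lemma ofReal_sq_add_one_ne_zero (t : ℝ) : (t : ℂ) ^ 2 + 1 ≠ 0 := by
  have : ((t ^ 2 + 1 : ℝ) : ℂ) ≠ 0 := Complex.ofReal_ne_zero.2 (by positivity)
  simpa using this

lemma inv_norm_sub_sq_le {z : ℂ} {d R : ℝ} (hd : 0 < d) (hz : d ≤ z.im) (hR : ‖z‖ ≤ R) (t : ℝ) :
    (‖(t : ℂ) - z‖ ^ 2)⁻¹ ≤ (2 + (1 + 2 * R ^ 2) / d ^ 2) * (t ^ 2 + 1)⁻¹ := by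
  have h1 : ‖(t : ℂ) - z‖ ^ 2 = (t - z.re) ^ 2 + z.im ^ 2 := by
    rw [← Complex.normSq_eq_norm_sq, Complex.normSq_apply]; simp; ring
  rw [h1]
  have hre : z.re ^ 2 ≤ R ^ 2 := by
    rw [← sq_abs]
    have := (Complex.abs_re_le_norm z).trans hR
    gcongr
  refine (inv_sq_add_sq_le hd (by nlinarith [sq_nonneg (t - z.re)])).trans ?_
  gcongr

/-- The regularised Cauchy kernel. -/
noncomputable def cauchyKernel (z : ℂ) (t : ℝ) : ℂ :=
  ((t : ℂ) - z)⁻¹ - (t : ℂ) / ((t : ℂ) ^ 2 + 1)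

lemma norm_cauchyKernel_le {z : ℂ} {d R : ℝ} (hd : 0 < d) (hz : d ≤ z.im) (hR : ‖z‖ ≤ R) (t : ℝ) :
    ‖cauchyKernel z t‖ ≤
      ((R + 1) * ((2 + (1 + 2 * R ^ 2) / d ^ 2) + 1) + 1) * (t ^ 2 + 1)⁻¹ := by
  have hR0 : 0 ≤ R := (norm_nonneg z).trans hR
  have h0 := norm_ofReal_sub_pos (hd.trans_le hz) t
  have hi := norm_ofReal_sub_pos (z := Complex.I) (by simp) t
  have h2 : (t : ℂ) ^ 2 + 1 = (t - Complex.I) * (t + Complex.I) := by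
    ring_nf; simp; ring
  have hni : ‖(t : ℂ) - Complex.I‖ ^ 2 = t ^ 2 + 1 := by
    rw [← Complex.normSq_eq_norm_sq, Complex.normSq_apply]; simp; ring
  have hn2 : ‖(t : ℂ) ^ 2 + 1‖ = t ^ 2 + 1 := by
    have : ((t ^ 2 + 1 : ℝ) : ℂ) = (t : ℂ) ^ 2 + 1 := by push_cast; ring
    rw [← this, Complex.norm_real, Real.norm_of_nonneg (by positivity)]
  have e : cauchyKernel z t =
      (z - Complex.I) * (((t : ℂ) - z)⁻¹ * ((t : ℂ) - Complex.I)⁻¹) +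
        Complex.I * ((t : ℂ) ^ 2 + 1)⁻¹ := by
    have hz' := norm_pos_iff.1 h0
    have hi' := norm_pos_iff.1 hi
    have h3 := ofReal_sq_add_one_ne_zero t
    have h4 : (t : ℂ) + Complex.I ≠ 0 := fun h => h3 (by rw [h2, h, mul_zero])
    rw [cauchyKernel, h2]
    field_simp
    ring
  rw [e]
  have hamgm : ‖(t : ℂ) - z‖⁻¹ * ‖(t : ℂ) - Complex.I‖⁻¹ ≤
      ((2 + (1 + 2 * R ^ 2) / d ^ 2) + 1) * (t ^ 2 + 1)⁻¹ := by
    have h5 := inv_norm_sub_sq_le hd hz hR t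
    have h6 : (‖(t : ℂ) - Complex.I‖⁻¹) ^ 2 = (t ^ 2 + 1)⁻¹ := by rw [inv_pow, hni]
    rw [← inv_pow] at h5
    nlinarith [sq_nonneg (‖(t : ℂ) - z‖⁻¹ - ‖(t : ℂ) - Complex.I‖⁻¹),
      sq_nonneg (‖(t : ℂ) - z‖⁻¹), sq_nonneg (‖(t : ℂ) - Complex.I‖⁻¹)]
  have hzI : ‖z - Complex.I‖ ≤ R + 1 := (norm_sub_le _ _).trans (by simpa using hR)
  refine (norm_add_le _ _).trans ?_
  rw [norm_mul, norm_mul, norm_mul, norm_inv, norm_inv, norm_inv, hn2, Complex.norm_I, one_mul,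
    add_mul, one_mul, mul_assoc]
  gcongr

lemma measurable_cauchyKernel (z : ℂ) : Measurable (cauchyKernel z) := by
  unfold cauchyKernel; fun_prop

/-- The Cauchy transform of `θ dν`. -/
noncomputable def cauchyTransform (ν : Measure ℝ) (θ : ℝ → ℝ) (z : ℂ) : ℂ :=
  ∫ t, cauchyKernel z t * θ t ∂ν

section CauchyTransform

variable {ν : Measure ℝ} {θ : ℝ → ℝ} {M : ℝ}

lemma integrable_cauchyKernel_mul (hν : Integrable (fun t : ℝ => (t ^ 2 + 1)⁻¹) ν)
    (hθ : Measurable θ) (hM : ∀ᵐ t ∂ν, |θ t| ≤ M) {z : ℂ} (hz : 0 < z.im) :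
    Integrable (fun t => cauchyKernel z t * θ t) ν := by
  refine ((hν.const_mul ((‖z‖ + 1) * ((2 + (1 + 2 * ‖z‖ ^ 2) / z.im ^ 2) + 1) + 1)).mul_const M).mono'
    ((measurable_cauchyKernel z).mul (by fun_prop)).aestronglyMeasurable ?_
  filter_upwards [hM] with t ht
  rw [norm_mul, Complex.norm_real]
  exact mul_le_mul (norm_cauchyKernel_le hz le_rfl le_rfl t) ht (norm_nonneg _)
    (by positivity)

lemma differentiableOn_cauchyTransform (hν : Integrable (fun t : ℝ => (t ^ 2 + 1)⁻¹) ν)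
    (hθ : Measurable θ) (hM : ∀ᵐ t ∂ν, |θ t| ≤ M) :
    DifferentiableOn ℂ (cauchyTransform ν θ) {z | 0 < z.im} := by
  intro z hz
  have hz' : 0 < z.im := hz
  have himb : ∀ v ∈ Metric.ball z (z.im / 2), z.im / 2 ≤ v.im := fun v hv => by
    rw [mem_ball_iff_norm] at hv
    have := (Complex.abs_im_le_norm (v - z)).trans hv.le
    rw [Complex.sub_im, abs_le] at this
    linarith [this.1]
  have hnb : ∀ v ∈ Metric.ball z (z.im / 2), ‖v‖ ≤ ‖z‖ + z.im / 2 := fun v hv => by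
    rw [mem_ball_iff_norm] at hv
    have := norm_sub_norm_le v z
    linarith
  refine DifferentiableAt.differentiableWithinAt (HasDerivAt.differentiableAt
    (hasDerivAt_integral_of_dominated_loc_of_deriv_le (μ := ν) (𝕜 := ℂ)
      (F := fun v t => cauchyKernel v t * θ t)
      (F' := fun v t => (((t : ℂ) - v) ^ 2)⁻¹ * θ t)
      (bound := fun t => (2 + (1 + 2 * (‖z‖ + z.im / 2) ^ 2) / (z.im / 2) ^ 2) *
        (t ^ 2 + 1)⁻¹ * M)
      (Metric.ball_mem_nhds z (half_pos hz')) ?_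
      (integrable_cauchyKernel_mul hν hθ hM hz) ?_ ?_ ((hν.const_mul _).mul_const M) ?_).2)
  · exact Eventually.of_forall fun v =>
      ((measurable_cauchyKernel v).mul (by fun_prop)).aestronglyMeasurable
  · exact Measurable.aestronglyMeasurable (by fun_prop)
  · filter_upwards [hM] with t ht v hv
    rw [norm_mul, Complex.norm_real, norm_inv, norm_pow]
    exact mul_le_mul (inv_norm_sub_sq_le (half_pos hz') (himb v hv) (hnb v hv) t) ht
      (norm_nonneg _) (by positivity)
  · refine ae_of_all _ fun t v hv => ?_
    have hv0 : (t : ℂ) - v ≠ 0 :=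
      norm_pos_iff.1 (norm_ofReal_sub_pos ((half_pos hz').trans_le (himb v hv)) t)
    have h1 : HasDerivAt (fun v : ℂ => (t : ℂ) - v) (-1) v := by
      simpa using (hasDerivAt_id v).const_sub (t : ℂ)
    have h2 := ((h1.fun_inv hv0).sub_const ((t : ℂ) / ((t : ℂ) ^ 2 + 1))).mul_const (θ t : ℂ)
    simpa [cauchyKernel] using h2

lemma cauchyKernel_re (x y t : ℝ) : (cauchyKernel (x + y * Complex.I) t).re =
    (t - x) / ((t - x) ^ 2 + y ^ 2) - t / (t ^ 2 + 1) := by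
  have h : (t : ℂ) / ((t : ℂ) ^ 2 + 1) = ((t / (t ^ 2 + 1) : ℝ) : ℂ) := by push_cast; ring
  rw [cauchyKernel, h, Complex.sub_re, Complex.ofReal_re, Complex.inv_re, Complex.normSq_apply]
  simp [sq]

lemma cauchyKernel_im (x y t : ℝ) : (cauchyKernel (x + y * Complex.I) t).im =
    halfPlanePoisson x y t := by
  have h : (t : ℂ) / ((t : ℂ) ^ 2 + 1) = ((t / (t ^ 2 + 1) : ℝ) : ℂ) := by push_cast; ring
  rw [cauchyKernel, h, Complex.sub_im, Complex.ofReal_im, Complex.inv_im, Complex.normSq_apply]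
  simp [sq, halfPlanePoisson]

lemma cauchyTransform_re (hν : Integrable (fun t : ℝ => (t ^ 2 + 1)⁻¹) ν)
    (hθ : Measurable θ) (hM : ∀ᵐ t ∂ν, |θ t| ≤ M) (x : ℝ) {y : ℝ} (hy : 0 < y) :
    (cauchyTransform ν θ (x + y * Complex.I)).re =
      ∫ t, ((t - x) / ((t - x) ^ 2 + y ^ 2) - t / (t ^ 2 + 1)) * θ t ∂ν := by
  have h := integral_re (integrable_cauchyKernel_mul hν hθ hM (z := x + y * Complex.I)
    (by simpa using hy))
  simp only [RCLike.re_eq_complex_re] at h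
  rw [cauchyTransform, ← h]
  simp only [Complex.re_mul_ofReal, cauchyKernel_re]

lemma cauchyTransform_im (hν : Integrable (fun t : ℝ => (t ^ 2 + 1)⁻¹) ν)
    (hθ : Measurable θ) (hM : ∀ᵐ t ∂ν, |θ t| ≤ M) (x : ℝ) {y : ℝ} (hy : 0 < y) :
    (cauchyTransform ν θ (x + y * Complex.I)).im = ∫ t, halfPlanePoisson x y t * θ t ∂ν := by
  have h := integral_im (integrable_cauchyKernel_mul hν hθ hM (z := x + y * Complex.I)
    (by simpa using hy))
  simp only [RCLike.im_eq_complex_im] at h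
  rw [cauchyTransform, ← h]
  simp only [Complex.im_mul_ofReal, cauchyKernel_im]

lemma abs_cauchyTransform_im_le (hν : Integrable (fun t : ℝ => (t ^ 2 + 1)⁻¹) ν)
    (hθ : Measurable θ) (hM : ∀ᵐ t ∂ν, |θ t| ≤ M) (x : ℝ) {y : ℝ} (hy : 0 < y) :
    |(cauchyTransform ν θ (x + y * Complex.I)).im| ≤ M * poissonIntegral ν x y := by
  rw [cauchyTransform_im hν hθ hM x hy, ← Real.norm_eq_abs, poissonIntegral, ← integral_const_mul]
  refine norm_integral_le_of_norm_le ((integrable_halfPlanePoisson hν hy x).const_mul M) ?_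
  filter_upwards [hM] with t ht
  rw [norm_mul, Real.norm_of_nonneg (halfPlanePoisson_pos hy x t).le, mul_comm]
  exact mul_le_mul_of_nonneg_right ht (halfPlanePoisson_pos hy x t).le

end CauchyTransform

section BoundaryValues

variable {H : ℂ → ℂ}

lemma tendsto_const_mul_nhdsGT_zero (β : ℝ) :
    Tendsto (fun y : ℝ => β * y) (𝓝[>] 0) (𝓝 0) := by
  have : Tendsto (fun y : ℝ => β * y) (𝓝 0) (𝓝 (β * 0)) := tendsto_id.const_mul β
  rw [mul_zero] at this
  exact this.mono_left nhdsWithin_le_nhds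

lemma ae_tendsto_poissonIntegral {ρ : Measure ℝ} (hρ : Integrable (fun t : ℝ => (t ^ 2 + 1)⁻¹) ρ) :
    ∀ᵐ x, Tendsto (fun y => poissonIntegral ρ x y) (𝓝[>] 0)
      (𝓝 (Real.pi * (ρ.rnDeriv volume x).toReal)) := by
  filter_upwards [ae_tendsto_poissonIntegral_div hρ integrable_inv_sq_volume] with x hx
  refine (hx.2.const_mul Real.pi).congr' ?_
  filter_upwards [self_mem_nhdsWithin] with y hy
  rw [poissonIntegral_volume x hy, mul_div_cancel₀ _ Real.pi_ne_zero]

lemma ae_exists_tendsto_im (hH : DifferentiableOn ℂ H {z | 0 < z.im})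
    (hpos : ∀ z, 0 < z.im → 0 ≤ (H z).im) :
    ∀ᵐ x : ℝ, ∃ l, Tendsto (fun y : ℝ => (H (x + y * Complex.I)).im) (𝓝[>] 0) (𝓝 l) := by
  obtain ⟨β, ρ, -, hρ, hrep⟩ := exists_poissonIntegral_repr hH hpos
  filter_upwards [ae_tendsto_poissonIntegral hρ] with x hx
  refine ⟨_, ((tendsto_const_mul_nhdsGT_zero β).add hx).congr' ?_⟩
  filter_upwards [self_mem_nhdsWithin] with y hy
  exact (hrep x y hy).symm

lemma le_im_of_ae_tendsto (hH : DifferentiableOn ℂ H {z | 0 < z.im})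
    (hpos : ∀ z, 0 < z.im → 0 ≤ (H z).im) {E : Set ℝ} (hE : MeasurableSet E) {c : ℝ} (hc : 0 ≤ c)
    (hlim : ∀ᵐ t : ℝ ∂volume.restrict E,
      Tendsto (fun y : ℝ => (H (t + y * Complex.I)).im) (𝓝[>] 0) (𝓝 (Real.pi * c)))
    (x : ℝ) {y : ℝ} (hy : 0 < y) :
    c * poissonIntegral (volume.restrict E) x y ≤ (H (x + y * Complex.I)).im := by
  obtain ⟨β, ρ, hβ, hρ, hrep⟩ := exists_poissonIntegral_repr hH hpos
  have hd : ∀ᵐ t : ℝ ∂volume.restrict E, ENNReal.ofReal c ≤ ρ.rnDeriv volume t := by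
    filter_upwards [hlim, ae_restrict_of_ae (ae_tendsto_poissonIntegral hρ)] with t h1 h2
    have h3 : Tendsto (fun y : ℝ => (H (t + y * Complex.I)).im) (𝓝[>] 0)
        (𝓝 (0 + Real.pi * (ρ.rnDeriv volume t).toReal)) := by
      refine ((tendsto_const_mul_nhdsGT_zero β).add h2).congr' ?_
      filter_upwards [self_mem_nhdsWithin] with y hy
      exact (hrep t y hy).symm
    have h4 := tendsto_nhds_unique h1 h3
    rw [zero_add] at h4
    rw [mul_left_cancel₀ Real.pi_ne_zero h4]
    exact ENNReal.ofReal_toReal_le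
  have hle : c.toNNReal • volume.restrict E ≤ ρ := by
    calc c.toNNReal • volume.restrict E
        = (volume.restrict E).withDensity fun _ => ENNReal.ofReal c := by
          rw [withDensity_const]; rfl
      _ ≤ (volume.restrict E).withDensity (ρ.rnDeriv volume) := withDensity_mono hd
      _ = (volume.withDensity (ρ.rnDeriv volume)).restrict E := (restrict_withDensity hE _).symm
      _ ≤ volume.withDensity (ρ.rnDeriv volume) := Measure.restrict_le_self
      _ ≤ ρ := Measure.withDensity_rnDeriv_le _ _
  have hint : poissonIntegral (c.toNNReal • volume.restrict E) x y ≤ poissonIntegral ρ x y :=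
    integral_mono_measure hle (ae_of_all _ fun t => (halfPlanePoisson_pos hy x t).le)
      (integrable_halfPlanePoisson hρ hy x)
  rw [poissonIntegral_nnreal_smul, Real.coe_toNNReal _ hc] at hint
  rw [hrep x y hy]
  have := mul_nonneg hβ hy.le
  linarith

lemma ae_eventually_norm_le (hH : DifferentiableOn ℂ H {z | 0 < z.im})
    (hpos : ∀ z, 0 < z.im → 0 < (H z).im) :
    ∀ᵐ x : ℝ, ∃ B, ∀ᶠ y : ℝ in 𝓝[>] (0 : ℝ), ‖H (x + y * Complex.I)‖ ≤ B := by
  set S : ℂ → ℂ := fun z => Complex.exp (Complex.log (H z) / 2) with hS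
  have hSd : DifferentiableOn ℂ S {z | 0 < z.im} :=
    DifferentiableOn.cexp (DifferentiableOn.div_const
      (DifferentiableOn.clog hH fun z hz => Or.inr (hpos z hz).ne') 2)
  have him : ∀ z, (Complex.log (H z) / 2).im = (H z).arg / 2 := fun z => by
    rw [Complex.div_ofNat_im, Complex.log_im]
  have harg : ∀ z, 0 < z.im → 0 ≤ (H z).arg ∧ (H z).arg ≤ Real.pi := fun z hz =>
    ⟨Complex.arg_nonneg_iff.2 (hpos z hz).le, Complex.arg_le_pi (H z)⟩
  have h1 : ∀ z, 0 < z.im → 0 ≤ (S z).im := fun z hz => by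
    rw [hS, Complex.exp_im, him]
    have := harg z hz
    exact mul_nonneg (Real.exp_pos _).le
      (Real.sin_nonneg_of_nonneg_of_le_pi (by linarith) (by linarith))
  have h2 : ∀ z, 0 < z.im → 0 ≤ (Complex.I * S z).im := fun z hz => by
    rw [Complex.I_mul_im, hS, Complex.exp_re, him]
    have := harg z hz
    exact mul_nonneg (Real.exp_pos _).le
      (Real.cos_nonneg_of_neg_pi_div_two_le_of_le (by linarith) (by linarith))
  have hsq : ∀ z, 0 < z.im → ‖H z‖ = (S z).re ^ 2 + (S z).im ^ 2 := fun z hz => by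
    have h0 : H z ≠ 0 := fun h => (hpos z hz).ne' (by simp [h])
    have : S z * S z = H z := by
      rw [hS, ← Complex.exp_add, add_halves, Complex.exp_log h0]
    rw [← this, norm_mul, Complex.norm_mul_self_eq_normSq, Complex.normSq_apply]; ring
  filter_upwards [ae_exists_tendsto_im hSd h1, ae_exists_tendsto_im (hSd.const_mul Complex.I) h2]
    with x ⟨l, hl⟩ ⟨m, hm⟩
  have hlim := (hm.pow 2).add (hl.pow 2)
  refine ⟨m ^ 2 + l ^ 2 + 1, ?_⟩
  filter_upwards [hlim.eventually_le_const (lt_add_one _), self_mem_nhdsWithin] with y h3 hy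
  rw [hsq _ (by simpa using hy)]
  simpa using h3

lemma ae_tendsto_arg_of_tendsto_re (hH : DifferentiableOn ℂ H {z | 0 < z.im})
    (hpos : ∀ z, 0 < z.im → 0 < (H z).im) :
    ∀ᵐ x : ℝ, Tendsto (fun y : ℝ => (H (x + y * Complex.I)).re) (𝓝[>] 0) (𝓝 0) →
      Tendsto (fun y : ℝ => (H (x + y * Complex.I)).arg) (𝓝[>] 0) (𝓝 (Real.pi / 2)) := by
  have h0 : ∀ z, 0 < z.im → H z ≠ 0 := fun z hz h => (hpos z hz).ne' (by simp [h])
  have hd : DifferentiableOn ℂ (fun z => -(H z)⁻¹) {z | 0 < z.im} := (hH.inv h0).neg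
  have hp : ∀ z, 0 < z.im → 0 < (-(H z)⁻¹).im := fun z hz => by
    rw [Complex.neg_im, Complex.inv_im, neg_div, neg_neg]
    exact div_pos (hpos z hz) (Complex.normSq_pos.2 (h0 z hz))
  filter_upwards [ae_eventually_norm_le hd hp] with x ⟨B, hB⟩ hre
  have hq : Tendsto (fun y : ℝ => (H (x + y * Complex.I)).re / ‖H (x + y * Complex.I)‖)
      (𝓝[>] 0) (𝓝 0) := by
    refine squeeze_zero_norm' (a := fun y : ℝ => |(H (x + y * Complex.I)).re| * B) ?_
      (by simpa using hre.abs.mul_const B)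
    filter_upwards [hB] with y hy
    rw [norm_neg, norm_inv] at hy
    rw [norm_div, norm_norm, div_eq_mul_inv, Real.norm_eq_abs]
    gcongr
  have := (Real.continuous_arccos.tendsto 0).comp hq
  rw [Real.arccos_zero] at this
  refine this.congr' ?_
  filter_upwards [self_mem_nhdsWithin] with y hy
  have hy' : 0 < ((x : ℂ) + y * Complex.I).im := by simpa using hy
  exact (Complex.arg_of_im_nonneg_of_ne_zero (hpos _ hy').le (h0 _ hy')).symm

end BoundaryValues

lemma exists_tendsto_of_tendsto_exp_mul {l : Filter ℝ} [l.NeBot] {u φ q : ℝ → ℝ}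
    (hφ : ∀ᶠ y in l, |φ y| ≤ Real.pi / 4)
    (hs : ∀ k : ℤ, |(k : ℝ)| ≤ 2 → ∃ s, Tendsto
      (fun y => Real.exp (k * u y) * (Real.cos (k * φ y) + q y * Real.sin (k * φ y))) l (𝓝 s)) :
    ∃ L, Tendsto u l (𝓝 L) := by
  obtain ⟨a, ha⟩ := hs 1 (by norm_num)
  obtain ⟨b, hb⟩ := hs (-1) (by norm_num)
  obtain ⟨c, hc⟩ := hs 2 (by norm_num)
  obtain ⟨d, hd⟩ := hs (-2) (by norm_num)
  simp only [Int.cast_one, Int.cast_neg, Int.cast_ofNat, neg_mul, one_mul, Real.cos_neg,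
    Real.sin_neg, Real.exp_neg, mul_neg, ← sub_eq_add_neg, Real.cos_two_mul', Real.sin_two_mul]
    at ha hb hc hd
  have he : ∀ y, Real.exp (2 * u y) = Real.exp (u y) ^ 2 := fun y => by
    rw [← Real.exp_nat_mul]; norm_num
  simp only [he] at hc hd
  have hΔ : Tendsto (fun y => Real.sin (φ y) ^ 2 * (1 + q y ^ 2)) l (𝓝 (1 - a * b)) := by
    refine (tendsto_const_nhds.sub (ha.mul hb)).congr fun y => ?_
    have := Real.exp_pos (u y)
    field_simp
    linear_combination (-1 : ℝ) * Real.sin_sq_add_cos_sq (φ y)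
  by_cases hD : 1 - a * b = 0
  · have hsin : Tendsto (fun y => Real.sin (φ y) ^ 2) l (𝓝 0) := by
      rw [hD] at hΔ
      refine squeeze_zero (fun y => sq_nonneg _) (fun y => ?_) hΔ
      nlinarith [mul_nonneg (sq_nonneg (Real.sin (φ y))) (sq_nonneg (q y))]
    have hqsin : Tendsto (fun y => q y * Real.sin (φ y)) l (𝓝 0) := by
      rw [hD] at hΔ
      have : Tendsto (fun y => (q y * Real.sin (φ y)) ^ 2) l (𝓝 0) := by
        refine squeeze_zero (fun y => sq_nonneg _) (fun y => ?_) hΔ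
        nlinarith [sq_nonneg (Real.sin (φ y))]
      rw [tendsto_zero_iff_abs_tendsto_zero]
      simpa [Function.comp_def, Real.sqrt_sq_eq_abs] using this.sqrt
    have hcos : Tendsto (fun y => Real.cos (φ y)) l (𝓝 1) := by
      have h1 := (tendsto_const_nhds (x := (1 : ℝ)).sub hsin).sqrt
      rw [sub_zero, Real.sqrt_one] at h1
      refine h1.congr' ?_
      filter_upwards [hφ] with y hy
      rw [abs_le] at hy
      have := Real.pi_pos
      rw [← Real.cos_sq', Real.sqrt_sq (Real.cos_nonneg_of_neg_pi_div_two_le_of_le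
        (by linarith) (by linarith))]
    have hm := hcos.add hqsin
    rw [add_zero] at hm
    have hR : Tendsto (fun y => Real.exp (u y)) l (𝓝 a) := by
      have h1 := ha.div hm one_ne_zero
      rw [div_one] at h1
      refine h1.congr' ?_
      filter_upwards [hm.eventually_ne one_ne_zero] with y hy
      exact mul_div_cancel_right₀ _ hy
    have ha0 : a ≠ 0 := fun h => by simp [h] at hD
    exact ⟨_, (hR.log ha0).congr fun y => Real.log_exp _⟩
  · have hA : Tendsto (fun y => Real.exp (u y) ^ 2) l (𝓝 ((a ^ 2 - c) / (1 - a * b))) := by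
      refine (((ha.pow 2).sub hc).div hΔ hD).congr' ?_
      filter_upwards [hΔ.eventually_ne hD] with y hy
      rw [Pi.div_apply, div_eq_iff hy]
      ring
    have hB : Tendsto (fun y => (Real.exp (u y) ^ 2)⁻¹) l (𝓝 ((b ^ 2 - d) / (1 - a * b))) := by
      refine (((hb.pow 2).sub hd).div hΔ hD).congr' ?_
      filter_upwards [hΔ.eventually_ne hD] with y hy
      rw [Pi.div_apply, div_eq_iff hy]
      ring
    have hAB := tendsto_nhds_unique (hA.mul hB) (tendsto_const_nhds.congr fun y =>
      (mul_inv_cancel₀ (pow_ne_zero 2 (Real.exp_ne_zero (u y)))).symm)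
    have hA0 := left_ne_zero_of_mul_eq_one hAB
    refine ⟨_, ((hA.log hA0).div_const 2).congr fun y => ?_⟩
    rw [Real.log_pow, Real.log_exp]
    norm_num

section Herglotz

variable {μ : Measure ℝ} {a b : ℝ}

lemma herglotzFn_eq (μ : Measure ℝ) (a b : ℝ) (z : ℂ) :
    herglotzFn μ a b z = a + b * z + cauchyTransform μ (fun _ => 1) z := by
  simp only [herglotzFn, cauchyTransform, cauchyKernel, Complex.ofReal_one, mul_one]

lemma differentiableOn_herglotzFn (hμ : Integrable (fun t : ℝ => (t ^ 2 + 1)⁻¹) μ) :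
    DifferentiableOn ℂ (herglotzFn μ a b) {z | 0 < z.im} := by
  have h : DifferentiableOn ℂ (cauchyTransform μ fun _ => 1) {z | 0 < z.im} :=
    differentiableOn_cauchyTransform (M := 1) hμ measurable_const (by simp)
  rw [funext (herglotzFn_eq μ a b)]
  exact DifferentiableOn.add (by fun_prop) h

lemma herglotzFn_im (hμ : Integrable (fun t : ℝ => (t ^ 2 + 1)⁻¹) μ) (x : ℝ) {y : ℝ} (hy : 0 < y) :
    (herglotzFn μ a b (x + y * Complex.I)).im = b * y + poissonIntegral μ x y := by
  rw [herglotzFn_eq, Complex.add_im,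
    cauchyTransform_im (M := 1) hμ measurable_const (by simp) x hy]
  simp [poissonIntegral]

lemma herglotzFn_im_pos (hμ : Integrable (fun t : ℝ => (t ^ 2 + 1)⁻¹) μ) (h0 : μ ≠ 0)
    (hb : 0 ≤ b) {z : ℂ} (hz : 0 < z.im) : 0 < (herglotzFn μ a b z).im := by
  rw [← Complex.re_add_im z, herglotzFn_im hμ _ hz]
  exact add_pos_of_nonneg_of_pos (mul_nonneg hb hz.le) (poissonIntegral_pos hμ h0 _ hz)

lemma ae_exists_tendsto_im_div_herglotzFn_im
    (hμ : Integrable (fun t : ℝ => (t ^ 2 + 1)⁻¹) μ) {H : ℂ → ℂ}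
    (hH : DifferentiableOn ℂ H {z | 0 < z.im}) (hpos : ∀ z, 0 < z.im → 0 ≤ (H z).im) :
    ∀ᵐ x : ℝ ∂μ, ∃ s, Tendsto (fun y : ℝ => (H (x + y * Complex.I)).im /
      (herglotzFn μ a b (x + y * Complex.I)).im) (𝓝[>] 0) (𝓝 s) := by
  obtain ⟨β, ρ, -, hρ, hrep⟩ := exists_poissonIntegral_repr hH hpos
  filter_upwards [ae_tendsto_poissonIntegral_div hρ hμ] with x ⟨⟨c, hc, hcP⟩, hx⟩
  have hdiv : ∀ γ : ℝ, Tendsto (fun y => γ * y / poissonIntegral μ x y) (𝓝[>] 0) (𝓝 0) := by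
    intro γ
    have h1 := (tendsto_const_mul_nhdsGT_zero γ).abs.div_const c
    rw [abs_zero, zero_div] at h1
    refine squeeze_zero_norm' ?_ h1
    filter_upwards [hcP] with y hy
    rw [norm_div, Real.norm_eq_abs, Real.norm_of_nonneg (hc.le.trans hy)]
    gcongr
  refine ⟨_, (((hdiv β).add hx).div ((hdiv b).add_const 1) (by norm_num)).congr' ?_⟩
  filter_upwards [hcP, self_mem_nhdsWithin] with y hy hy0
  have hP : poissonIntegral μ x y ≠ 0 := (hc.trans_le hy).ne'
  rw [Pi.div_apply, hrep x y hy0, herglotzFn_im hμ x hy0, ← add_div, ← div_self hP, ← add_div,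
    div_div_div_cancel_right₀ hP]

end Herglotz

lemma integrable_inv_sq_restrict (E : Set ℝ) :
    Integrable (fun t : ℝ => (t ^ 2 + 1)⁻¹) (volume.restrict E) :=
  integrable_inv_sq_volume.restrict

lemma poissonIntegral_restrict_le_pi (E : Set ℝ) (x : ℝ) {y : ℝ} (hy : 0 < y) :
    poissonIntegral (volume.restrict E) x y ≤ Real.pi := by
  rw [← poissonIntegral_volume x hy]
  exact integral_mono_measure Measure.restrict_le_self
    (ae_of_all _ fun t => (halfPlanePoisson_pos hy x t).le)
    (integrable_halfPlanePoisson integrable_inv_sq_volume hy x)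

section Argument

variable {F : ℂ → ℂ} {E : Set ℝ}

lemma half_poissonIntegral_le_arg (hF : DifferentiableOn ℂ F {z | 0 < z.im})
    (hpos : ∀ z, 0 < z.im → 0 < (F z).im) (hE : MeasurableSet E)
    (href : ∀ᵐ t : ℝ ∂volume.restrict E,
      Tendsto (fun y : ℝ => (F (t + y * Complex.I)).re) (𝓝[>] 0) (𝓝 0))
    (x : ℝ) {y : ℝ} (hy : 0 < y) :
    1 / 2 * poissonIntegral (volume.restrict E) x y ≤ (F (x + y * Complex.I)).arg ∧
      (F (x + y * Complex.I)).arg ≤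
        Real.pi - 1 / 2 * poissonIntegral (volume.restrict E) x y := by
  have hlog : DifferentiableOn ℂ (fun z => Complex.log (F z)) {z | 0 < z.im} :=
    DifferentiableOn.clog hF fun z hz => Or.inr (hpos z hz).ne'
  have harg : ∀ᵐ t : ℝ ∂volume.restrict E, Tendsto (fun y : ℝ => (F (t + y * Complex.I)).arg)
      (𝓝[>] 0) (𝓝 (Real.pi * (1 / 2))) := by
    filter_upwards [href, ae_restrict_of_ae (ae_tendsto_arg_of_tendsto_re hF hpos)] with t h1 h2
    rw [mul_one_div]
    exact h2 h1
  have h1 := le_im_of_ae_tendsto hlog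
    (fun z hz => by
      rw [Complex.log_im]
      exact Complex.arg_nonneg_iff.2 (hpos z hz).le)
    hE one_half_pos.le (by simpa only [Complex.log_im] using harg) x hy
  have h2 := le_im_of_ae_tendsto (hlog.const_sub (Real.pi * Complex.I))
    (fun z hz => by
      simpa [Complex.log_im] using Complex.arg_le_pi (F z))
    hE one_half_pos.le
    (by
      filter_upwards [harg] with t ht
      have h3 := ht.const_sub Real.pi
      have h4 : Real.pi - Real.pi * (1 / 2) = Real.pi * (1 / 2) := by ring
      rw [h4] at h3
      simpa [Complex.log_im] using h3) x hy
  rw [Complex.log_im] at h1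
  have h5 : ((Real.pi : ℂ) * Complex.I - Complex.log (F (x + y * Complex.I))).im =
      Real.pi - (F (x + y * Complex.I)).arg := by simp [Complex.log_im]
  rw [h5] at h2
  exact ⟨h1, by linarith⟩

lemma im_mul_exp_nonneg (hF : DifferentiableOn ℂ F {z | 0 < z.im})
    (hpos : ∀ z, 0 < z.im → 0 < (F z).im) (hE : MeasurableSet E)
    (href : ∀ᵐ t : ℝ ∂volume.restrict E,
      Tendsto (fun y : ℝ => (F (t + y * Complex.I)).re) (𝓝[>] 0) (𝓝 0))
    {G : ℂ → ℂ} (hG : ∀ x y : ℝ, 0 < y → |(G (x + y * Complex.I)).im| ≤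
      1 / 2 * poissonIntegral (volume.restrict E) x y) {z : ℂ} (hz : 0 < z.im) :
    0 ≤ (F z * Complex.exp (G z)).im := by
  have hF0 : F z ≠ 0 := fun h => (hpos z hz).ne' (by simp [h])
  have h1 := half_poissonIntegral_le_arg hF hpos hE href z.re hz
  have h2 := abs_le.1 (hG z.re z.im hz)
  rw [Complex.re_add_im] at h1 h2
  rw [← Complex.exp_log hF0, ← Complex.exp_add, Complex.exp_im, Complex.add_im, Complex.log_im]
  exact mul_nonneg (Real.exp_pos _).le
    (Real.sin_nonneg_of_nonneg_of_le_pi (by linarith [h1.1]) (by linarith [h1.2]))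

end Argument

lemma mul_exp_im_div_im {w v : ℂ} (hw : w.im ≠ 0) :
    (w * Complex.exp v).im / w.im =
      Real.exp v.re * (Real.cos v.im + w.re / w.im * Real.sin v.im) := by
  rw [Complex.mul_im, Complex.exp_re, Complex.exp_im]
  field_simp
  ring

lemma ae_exists_tendsto_cauchyTransform_re {E : Set ℝ} (hE : MeasurableSet E) {μ : Measure ℝ}
    (hμ : IsReflectionless μ E) {θ : ℝ → ℝ} (hθ : Measurable θ) {M : ℝ} (hM0 : 0 ≤ M)
    (hM : ∀ᵐ t ∂volume.restrict E, |θ t| ≤ M) :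
    ∀ᵐ x : ℝ ∂μ, ∃ L, Tendsto
      (fun y : ℝ => (cauchyTransform (volume.restrict E) θ (x + y * Complex.I)).re)
      (𝓝[>] 0) (𝓝 L) := by
  obtain ⟨hμi, a, b, hb, href⟩ := hμ
  rcases eq_or_ne μ 0 with rfl | h0
  · simp
  set G := cauchyTransform (volume.restrict E) θ with hGdef
  set ε : ℝ := 1 / (4 * (M + 1)) with hε
  have hε0 : 0 < ε := by positivity
  have hεM : ε * M ≤ 1 / 4 := by
    rw [hε, div_mul_eq_mul_div, div_le_iff₀ (by positivity)]
    linarith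
  have hF := differentiableOn_herglotzFn (a := a) (b := b) hμi
  have hFpos : ∀ z : ℂ, 0 < z.im → 0 < (herglotzFn μ a b z).im :=
    fun z hz => herglotzFn_im_pos hμi h0 hb hz
  have hGd : DifferentiableOn ℂ G {z | 0 < z.im} :=
    differentiableOn_cauchyTransform (integrable_inv_sq_restrict E) hθ hM
  have hGim : ∀ (x : ℝ) {y : ℝ}, 0 < y → |ε * (G (x + y * Complex.I)).im| ≤
      1 / 4 * poissonIntegral (volume.restrict E) x y := fun x y hy => by
    rw [abs_mul, abs_of_pos hε0]
    calc ε * |(G (x + y * Complex.I)).im|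
        ≤ ε * (M * poissonIntegral (volume.restrict E) x y) := by
          gcongr
          exact abs_cauchyTransform_im_le (integrable_inv_sq_restrict E) hθ hM x hy
      _ = ε * M * poissonIntegral (volume.restrict E) x y := by ring
      _ ≤ _ := mul_le_mul_of_nonneg_right hεM (poissonIntegral_nonneg _ x hy)
  have hre : ∀ (k : ℤ) (z : ℂ), (((k * ε : ℝ) : ℂ) * G z).re = k * (ε * (G z).re) :=
    fun k z => by rw [Complex.re_ofReal_mul, mul_assoc]
  have him : ∀ (k : ℤ) (z : ℂ), (((k * ε : ℝ) : ℂ) * G z).im = k * (ε * (G z).im) :=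
    fun k z => by rw [Complex.im_ofReal_mul, mul_assoc]
  have hratio : ∀ᵐ x : ℝ ∂μ, ∀ k : ℤ, |(k : ℝ)| ≤ 2 → ∃ s, Tendsto (fun y : ℝ =>
      (herglotzFn μ a b (x + y * Complex.I) *
        Complex.exp (((k * ε : ℝ) : ℂ) * G (x + y * Complex.I))).im /
        (herglotzFn μ a b (x + y * Complex.I)).im) (𝓝[>] 0) (𝓝 s) := by
    rw [ae_all_iff]
    intro k
    by_cases hk : |(k : ℝ)| ≤ 2
    · refine (ae_exists_tendsto_im_div_herglotzFn_im hμi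
        (H := fun z => herglotzFn μ a b z * Complex.exp (((k * ε : ℝ) : ℂ) * G z))
        (hF.mul (hGd.const_mul _).cexp) fun z hz =>
          im_mul_exp_nonneg hF hFpos hE href (G := fun z => ((k * ε : ℝ) : ℂ) * G z)
            (fun x y hy => ?_) hz).mono fun x hx _ => hx
      rw [him, abs_mul]
      have h1 := mul_le_mul hk (hGim x hy) (abs_nonneg _) zero_le_two
      linarith
    · exact ae_of_all _ fun x h => absurd h hk
  filter_upwards [hratio] with x hx
  obtain ⟨L, hL⟩ := exists_tendsto_of_tendsto_exp_mul (l := 𝓝[>] (0 : ℝ))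
    (u := fun y => ε * (G (x + y * Complex.I)).re) (φ := fun y => ε * (G (x + y * Complex.I)).im)
    (q := fun y => (herglotzFn μ a b (x + y * Complex.I)).re /
      (herglotzFn μ a b (x + y * Complex.I)).im)
    (by
      filter_upwards [self_mem_nhdsWithin] with y hy
      have h1 := hGim x hy
      have h2 := poissonIntegral_restrict_le_pi E x hy
      linarith)
    (fun k hk => by
      obtain ⟨s, hs⟩ := hx k hk
      refine ⟨s, hs.congr' ?_⟩
      filter_upwards [self_mem_nhdsWithin] with y hy
      rw [mul_exp_im_div_im (hFpos _ (by simpa using hy)).ne', hre, him])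
  refine ⟨L / ε, (hL.div_const ε).congr fun y => ?_⟩
  exact mul_div_cancel_left₀ _ hε0.ne'

/-- Theorem 1.1(b): if `μ ∈ R(E)` and `θ ∈ L^∞(E)`, then the singular part of `μ` is
supported by the set of points `x` at which the transform
`(H̃_E θ)(x) = lim_{y→0+} ∫_E ((t-x)/((t-x)²+y²) - t/(t²+1)) θ(t) dt` exists. -/
theorem singularPart_supported_on_existence_of_transform
    (E : Set ℝ) (hE : MeasurableSet E) (μ : Measure ℝ) (hμ : IsReflectionless μ E)
    (θ : ℝ → ℝ) (hθmeas : Measurable θ) (hθbdd : ∃ M : ℝ, ∀ t ∈ E, |θ t| ≤ M) :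
    μ.singularPart volume
      {x : ℝ | ¬ ∃ L : ℝ, Tendsto
        (fun y : ℝ => ∫ t in E, ((t - x) / ((t - x) ^ 2 + y ^ 2) - t / (t ^ 2 + 1)) * θ t)
        (𝓝[>] (0 : ℝ)) (𝓝 L)} = 0 := by
  obtain ⟨M, hM⟩ := hθbdd
  have hM' : ∀ᵐ t ∂volume.restrict E, |θ t| ≤ |M| :=
    ae_restrict_of_forall_mem hE fun t ht => (hM t ht).trans (le_abs_self M)
  refine Measure.singularPart_le μ volume |>.absolutelyContinuous (ae_iff.1 ?_)
  filter_upwards [ae_exists_tendsto_cauchyTransform_re hE hμ hθmeas (abs_nonneg M) hM']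
    with x ⟨L, hL⟩
  refine ⟨L, hL.congr' ?_⟩
  filter_upwards [self_mem_nhdsWithin] with y hy
  exact cauchyTransform_re (integrable_inv_sq_restrict E) hθmeas hM' x hy
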